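/- Let d ≥ 1 and let ζ = {ζ_k}_{k∈ℤ^d} be a stationary random field of real-valued random variables with E[ζ_0] = 0 and Var(ζ_0) < ∞, satisfying σ̄² := Σ_{k∈ℤ^d} |Cov(ζ_0, ζ_k)| < ∞; set σ² := Σ_{k∈ℤ^d} Cov(ζ_0, ζ_k). Let 𝒟 ⊆ 𝒞 be dense in 𝒞 for the L²(ℝ^d) norm (i.e., for every φ ∈ 𝒞 and ε > 0 there exists ψ ∈ 𝒟 with ‖φ − ψ‖_{L²(ℝ^d)} < ε). Suppose that for every ψ ∈ 𝒟, S_n(ψ) converges in distribution, as n → ∞, to the centered normal law N(0, σ² ‖ψ‖²_{L²(ℝ^d)}). Then for every N ≥ 1 and every φ₁, …, φ_N ∈ 𝒞, the law of (S_n(φ₁), …, S_n(φ_N)) converges weakly, as n → ∞, to the centered Gaussian law on ℝ^N with covariance matrix (σ² ∫_{ℝ^d} φ_i(x) φ_j(x) dx)_{1≤i,j≤N}. -/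

import Mathlib

open MeasureTheory Filter Complex Topology

noncomputable section

/-- `S ζ n φ ω = n^{-d/2} ∑_{k ∈ ℤ^d} ζ_k(ω) φ(k/n)`. -/
def S {d : ℕ} {Ω : Type*} (ζ : (Fin d → ℤ) → Ω → ℝ) (n : ℕ)
    (φ : (Fin d → ℝ) → ℝ) (ω : Ω) : ℝ :=
  (n : ℝ) ^ (-(d : ℝ) / 2) * ∑' k : Fin d → ℤ, ζ k ω * φ (fun i => (k i : ℝ) / n)

/-- Stationarity of the random field: every lattice shift leaves the law invariant. -/
def Stationary {d : ℕ} {Ω : Type*} [MeasurableSpace Ω] (P : Measure Ω)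
    (ζ : (Fin d → ℤ) → Ω → ℝ) : Prop :=
  ∀ j : Fin d → ℤ,
    Measure.map (fun ω => fun k => ζ (k + j) ω) P
      = Measure.map (fun ω => fun k => ζ k ω) P

/-- Covariance of two real random variables. -/
def cov {Ω : Type*} [MeasurableSpace Ω] (P : Measure Ω) (X Y : Ω → ℝ) : ℝ :=
  ∫ ω, (X ω - ∫ x, X x ∂P) * (Y ω - ∫ x, Y x ∂P) ∂P

/-- Upright boxes `(a₁,b₁] × ⋯ × (a_d,b_d]`. -/
def IsBox {d : ℕ} (Q : Set (Fin d → ℝ)) : Prop :=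
  ∃ a b : Fin d → ℝ, (∀ i, a i < b i) ∧ Q = {x | ∀ i, a i < x i ∧ x i ≤ b i}

/-- The class 𝒰 of finite linear combinations of indicators of upright boxes. -/
def memU {d : ℕ} (φ : (Fin d → ℝ) → ℝ) : Prop :=
  ∃ (m : ℕ) (c : Fin m → ℝ) (Q : Fin m → Set (Fin d → ℝ)),
    (∀ l, IsBox (Q l)) ∧ φ = fun x => ∑ l, c l * (Q l).indicator (fun _ => (1 : ℝ)) x

/-- The class 𝒞 of bounded compactly supported functions continuous off a finite
union of hyperplanes. -/
def memC {d : ℕ} (φ : (Fin d → ℝ) → ℝ) : Prop :=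
  HasCompactSupport φ ∧ (∃ C : ℝ, ∀ x, |φ x| ≤ C) ∧
    ∃ (m : ℕ) (c : Fin m → Fin d → ℝ) (t : Fin m → ℝ),
      (∀ l, c l ≠ 0) ∧
      ContinuousOn φ (⋃ l, {x : Fin d → ℝ | ∑ i, c l i * x i = t l})ᶜ

/-- Separation of two subsets of ℝ^d in the sup metric
(`dist` on `Fin d → ℝ` is `max_i |x i - y i|`). -/
def sep {d : ℕ} (A B : Set (Fin d → ℝ)) : ℝ :=
  sInf (Set.image2 dist A B)

/-- Condition (AI): asymptotic independence of `S_n(φ₁), S_n(φ₂)` for separated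
supports. -/
def AI {d : ℕ} {Ω : Type*} [MeasurableSpace Ω] (P : Measure Ω)
    (ζ : (Fin d → ℤ) → Ω → ℝ) : Prop :=
  ∀ δ : ℝ, 0 < δ → ∀ φ₁ φ₂ : (Fin d → ℝ) → ℝ, memU φ₁ → memU φ₂ →
    δ ≤ sep (Function.support φ₁) (Function.support φ₂) →
    ∀ a b : ℝ,
      Tendsto (fun n : ℕ =>
          (∫ ω, Complex.exp (Complex.I * ((a * S ζ n φ₁ ω + b * S ζ n φ₂ ω : ℝ) : ℂ)) ∂P)
            - (∫ ω, Complex.exp (Complex.I * ((a * S ζ n φ₁ ω : ℝ) : ℂ)) ∂P)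
              * (∫ ω, Complex.exp (Complex.I * ((b * S ζ n φ₂ ω : ℝ) : ℂ)) ∂P))
        atTop (𝓝 0)


section MemC

variable {d : ℕ}

lemma memC.comp₂ {φ ψ : (Fin d → ℝ) → ℝ} (h : memC φ) (h' : memC ψ) {F : ℝ → ℝ → ℝ}
    (hF : Continuous (Function.uncurry F)) (hF0 : F 0 0 = 0) :
    memC (fun x => F (φ x) (ψ x)) := by
  obtain ⟨hs, ⟨C, hC⟩, m, c, t, hc, hcont⟩ := h
  obtain ⟨hs', ⟨C', hC'⟩, m', c', t', hc', hcont'⟩ := h'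
  refine ⟨hs.comp₂_left hs' hF0, ?_, m + m', Fin.append c c', Fin.append t t', ?_, ?_⟩
  · obtain ⟨K, hK⟩ := ((isCompact_Icc (a := -C) (b := C)).prod
      (isCompact_Icc (a := -C') (b := C'))).exists_bound_of_continuousOn hF.continuousOn
    exact ⟨K, fun x => hK (φ x, ψ x) ⟨abs_le.1 (hC x), abs_le.1 (hC' x)⟩⟩
  · intro l
    refine Fin.addCases (fun i => ?_) (fun i => ?_) l
    · simpa using hc i
    · simpa using hc' i
  · refine hF.comp_continuousOn ((hcont.mono ?_).prodMk (hcont'.mono ?_))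
    · refine Set.compl_subset_compl.2 (Set.iUnion_subset fun i => ?_)
      refine Set.subset_iUnion_of_subset (Fin.castAdd m' i) fun x hx => ?_
      simpa using hx
    · refine Set.compl_subset_compl.2 (Set.iUnion_subset fun i => ?_)
      refine Set.subset_iUnion_of_subset (Fin.natAdd m i) fun x hx => ?_
      simpa using hx

lemma memC.const_mul {φ : (Fin d → ℝ) → ℝ} (h : memC φ) (a : ℝ) :
    memC (fun x => a * φ x) :=
  h.comp₂ h (F := fun u _ => a * u) (by fun_prop) (by simp)

lemma memC.add {φ ψ : (Fin d → ℝ) → ℝ} (h : memC φ) (h' : memC ψ) :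
    memC (fun x => φ x + ψ x) :=
  h.comp₂ h' (F := fun u v => u + v) (by fun_prop) (by simp)

lemma memC.sub {φ ψ : (Fin d → ℝ) → ℝ} (h : memC φ) (h' : memC ψ) :
    memC (fun x => φ x - ψ x) :=
  h.comp₂ h' (F := fun u v => u - v) (by fun_prop) (by simp)

lemma memC.mul {φ ψ : (Fin d → ℝ) → ℝ} (h : memC φ) (h' : memC ψ) :
    memC (fun x => φ x * ψ x) :=
  h.comp₂ h' (F := fun u v => u * v) (by fun_prop) (by simp)

lemma memC.sq {φ : (Fin d → ℝ) → ℝ} (h : memC φ) : memC (fun x => φ x ^ 2) :=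
  h.comp₂ h (F := fun u _ => u ^ 2) (by fun_prop) (by simp)

lemma memC_zero : memC (fun _ : Fin d → ℝ => (0 : ℝ)) :=
  ⟨HasCompactSupport.zero, ⟨0, by simp⟩, 0, Fin.elim0, Fin.elim0, fun l => l.elim0,
    continuousOn_const⟩

lemma memC.sum {ι : Type*} (s : Finset ι) {φ : ι → (Fin d → ℝ) → ℝ} (h : ∀ i, memC (φ i)) :
    memC (fun x => ∑ i ∈ s, φ i x) := by
  classical
  induction s using Finset.induction_on with
  | empty => simpa using memC_zero
  | insert a s ha ih => simpa [Finset.sum_insert ha] using (h a).add ih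

lemma volume_hyperplane_eq_zero {c : Fin d → ℝ} (hc : c ≠ 0) (t : ℝ) :
    volume {x : Fin d → ℝ | ∑ i, c i * x i = t} = 0 := by
  classical
  obtain ⟨i₀, hi₀⟩ := Function.ne_iff.1 hc
  let f : (Fin d → ℝ) →ₗ[ℝ] ℝ := ∑ i, c i • LinearMap.proj i
  have hf : ∀ x, f x = ∑ i, c i * x i := fun x => by simp [f]
  let A : AffineSubspace ℝ (Fin d → ℝ) :=
    (AffineSubspace.mk' t (⊥ : Submodule ℝ ℝ)).comap f.toAffineMap
  have hA : (A : Set (Fin d → ℝ)) = {x | ∑ i, c i * x i = t} := by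
    ext x
    simp [A, AffineSubspace.mem_mk', hf, sub_eq_zero]
  rw [← hA]
  refine Measure.addHaar_affineSubspace _ _ fun htop => ?_
  have hall : ∀ x : Fin d → ℝ, ∑ i, c i * x i = t := fun x => by
    have : x ∈ (A : Set (Fin d → ℝ)) := by rw [htop]; trivial
    rwa [hA] at this
  have h0 := hall 0
  have h1 := hall (Pi.single i₀ 1)
  simp [Pi.single_apply] at h0 h1
  exact hi₀ (by simpa [← h0] using h1)

lemma memC.exists_isClosed_null {φ : (Fin d → ℝ) → ℝ} (h : memC φ) :
    ∃ Z : Set (Fin d → ℝ), IsClosed Z ∧ volume Z = 0 ∧ ContinuousOn φ Zᶜ := by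
  obtain ⟨-, -, m, c, t, hc, hcont⟩ := h
  exact ⟨_, isClosed_iUnion_of_finite fun l => isClosed_eq (by fun_prop) continuous_const,
    measure_iUnion_null fun l => volume_hyperplane_eq_zero (hc l) (t l), hcont⟩

lemma memC.ae_continuousAt {φ : (Fin d → ℝ) → ℝ} (h : memC φ) :
    ∀ᵐ x, ContinuousAt φ x := by
  obtain ⟨Z, hZ, hnull, hcont⟩ := h.exists_isClosed_null
  filter_upwards [measure_eq_zero_iff_ae_notMem.1 hnull] with x hx
  exact hcont.continuousAt (hZ.isOpen_compl.mem_nhds hx)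

lemma memC.exists_forall_norm_lt {φ : (Fin d → ℝ) → ℝ} (h : memC φ) :
    ∃ R : ℝ, ∀ x, R < ‖x‖ → φ x = 0 := by
  obtain ⟨R, hR⟩ := h.1.isCompact.isBounded.exists_norm_le
  refine ⟨R, fun x hx => ?_⟩
  by_contra hne
  exact absurd (hR x (subset_tsupport _ hne)) (not_le.2 hx)

/-- The scaled floor map, the lattice point of `n⁻¹ ℤ^d` below a given point. -/
def latticeFloor (n : ℕ) (x : Fin d → ℝ) : Fin d → ℤ := fun i => ⌊(n : ℝ) * x i⌋

lemma measurable_latticeFloor (n : ℕ) : Measurable (latticeFloor (d := d) n) :=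
  measurable_pi_lambda _ fun i => Int.measurable_floor.comp ((measurable_pi_apply i).const_mul _)

lemma dist_latticeFloor_div_le {n : ℕ} (hn : 0 < n) (x : Fin d → ℝ) :
    dist (fun i => (latticeFloor n x i : ℝ) / n) x ≤ 1 / n := by
  have hn' : (0 : ℝ) < n := Nat.cast_pos.2 hn
  refine (dist_pi_le_iff (by positivity)).2 fun i => ?_
  rw [Real.dist_eq, abs_le]
  have h1 := Int.floor_le ((n : ℝ) * x i)
  have h2 := Int.lt_floor_add_one ((n : ℝ) * x i)
  simp only [latticeFloor]
  constructor
  · rw [← sub_nonneg]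
    have : (⌊(n : ℝ) * x i⌋ : ℝ) / n - x i - -(1 / n) = (⌊(n : ℝ) * x i⌋ + 1 - n * x i) / n := by
      field_simp; ring
    rw [this]
    exact div_nonneg (by linarith) hn'.le
  · have : (⌊(n : ℝ) * x i⌋ : ℝ) / n ≤ x i := (div_le_iff₀ hn').2 (by linarith)
    have : (0 : ℝ) ≤ 1 / n := by positivity
    linarith

lemma volume_latticeFloor_preimage {n : ℕ} (hn : 0 < n) (k : Fin d → ℤ) :
    (Measure.map (latticeFloor n) (volume : Measure (Fin d → ℝ))).real {k} = ((n : ℝ) ^ d)⁻¹ := by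
  have hn' : (0 : ℝ) < n := Nat.cast_pos.2 hn
  have hset : latticeFloor n ⁻¹' {k} =
      Set.pi Set.univ fun i => Set.Ico ((k i : ℝ) / n) ((k i + 1 : ℝ) / n) := by
    ext x
    simp only [Set.mem_preimage, Set.mem_singleton_iff, funext_iff, latticeFloor, Int.floor_eq_iff,
      Set.mem_pi, Set.mem_univ, true_imp_iff, Set.mem_Ico, div_le_iff₀ hn', lt_div_iff₀ hn',
      mul_comm (n : ℝ)]
  rw [measureReal_def, Measure.map_apply (measurable_latticeFloor n) (measurableSet_singleton k),
    hset, Real.volume_pi_Ico]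
  have : ∀ i, ((k i + 1 : ℝ) / n) - (k i : ℝ) / n = (n : ℝ)⁻¹ := fun i => by field_simp; ring
  have hinv : (0 : ℝ) ≤ (n : ℝ)⁻¹ := by positivity
  simp [this, ENNReal.toReal_ofReal hinv]

/-- Riemann sums over `n⁻¹ ℤ^d` of a function of class `𝒞` converge to its integral. -/
lemma memC.tendsto_riemannSum {φ : (Fin d → ℝ) → ℝ} (h : memC φ) :
    Tendsto (fun n : ℕ => ((n : ℝ) ^ d)⁻¹ * ∑' k : Fin d → ℤ, φ (fun i => (k i : ℝ) / n))
      atTop (𝓝 (∫ x, φ x)) := by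
  obtain ⟨R, hR⟩ := h.exists_forall_norm_lt
  obtain ⟨C, hC⟩ := h.2.1
  let B : (Fin d → ℝ) → ℝ := (Metric.closedBall 0 (R + 1)).indicator fun _ => C
  have hB : Integrable B := (integrable_indicator_iff measurableSet_closedBall).2
    (integrableOn_const (measure_closedBall_lt_top.ne))
  let F : ℕ → (Fin d → ℝ) → ℝ := fun n x => φ (fun i => (latticeFloor n x i : ℝ) / n)
  have hFm : ∀ n, Measurable (F n) := fun n =>
    (Measurable.of_discrete (f := fun k : Fin d → ℤ => φ (fun i => (k i : ℝ) / n))).comp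
      (measurable_latticeFloor n)
  have hFB : ∀ n, 0 < n → ∀ x, ‖F n x‖ ≤ B x := fun n hn x => by
    by_cases hx : x ∈ Metric.closedBall (0 : Fin d → ℝ) (R + 1)
    · simpa [B, hx] using hC _
    · have hnorm : R + 1 < ‖x‖ := by simpa using hx
      have hd := dist_latticeFloor_div_le hn x
      rw [dist_eq_norm'] at hd
      have h1 : (1 : ℝ) / n ≤ 1 := by
        rw [div_le_one (Nat.cast_pos.2 hn)]
        exact_mod_cast hn
      have h2 := norm_sub_norm_le x (fun i => (latticeFloor n x i : ℝ) / n)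
      simp only [B, F, Set.indicator_of_notMem hx]
      rw [hR _ (by linarith), norm_zero]
  have hlim : Tendsto (fun n => ∫ x, F n x) atTop (𝓝 (∫ x, φ x)) := by
    refine tendsto_integral_filter_of_dominated_convergence B
      (Eventually.of_forall fun n => (hFm n).aestronglyMeasurable) ?_ hB ?_
    · filter_upwards [eventually_gt_atTop 0] with n hn
      exact Eventually.of_forall (hFB n hn)
    · filter_upwards [h.ae_continuousAt] with x hx
      refine hx.tendsto.comp (tendsto_iff_dist_tendsto_zero.2 ?_)
      refine squeeze_zero' (Eventually.of_forall fun n => dist_nonneg) ?_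
        tendsto_one_div_atTop_nhds_zero_nat
      filter_upwards [eventually_gt_atTop 0] with n hn
      exact dist_latticeFloor_div_le hn x
  refine hlim.congr' ?_
  filter_upwards [eventually_gt_atTop 0] with n hn
  have hint : Integrable (F n) := hB.mono' (hFm n).aestronglyMeasurable
    (Eventually.of_forall (hFB n hn))
  have hmap := integral_map (μ := volume) (measurable_latticeFloor (d := d) n).aemeasurable
    (Measurable.of_discrete
      (f := fun k : Fin d → ℤ => φ (fun i => (k i : ℝ) / n))).aestronglyMeasurable
  rw [show ∫ x, F n x = _ from hmap.symm, integral_countable]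
  · simp only [volume_latticeFloor_preimage hn, smul_eq_mul, tsum_mul_left]
  · exact (integrable_map_measure Measurable.of_discrete.aestronglyMeasurable
      (measurable_latticeFloor n).aemeasurable).2 hint

lemma memC.integrable {φ : (Fin d → ℝ) → ℝ} (h : memC φ) : Integrable φ := by
  obtain ⟨R, hR⟩ := h.exists_forall_norm_lt
  obtain ⟨C, hC⟩ := h.2.1
  have hmeas : AEStronglyMeasurable φ := by
    obtain ⟨Z, hZ, hnull, hcont⟩ := h.exists_isClosed_null
    have hres := hcont.aestronglyMeasurable (μ := volume) hZ.isOpen_compl.measurableSet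
    rwa [Measure.restrict_eq_self_of_ae_mem (s := Zᶜ)
      (measure_eq_zero_iff_ae_notMem.1 hnull)] at hres
  refine (integrableOn_iff_integrable_of_support_subset (s := Metric.closedBall 0 R) ?_).1
    (Measure.integrableOn_of_bounded (M := C) measure_closedBall_lt_top.ne hmeas
      (Eventually.of_forall hC))
  intro x hx
  by_contra hne
  exact hx (hR x (by simpa using hne))

lemma memC.finite_support_lattice {φ : (Fin d → ℝ) → ℝ} (h : memC φ) {n : ℕ} (hn : 0 < n) :
    (Function.support fun k : Fin d → ℤ => φ (fun i => (k i : ℝ) / n)).Finite := by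
  have hn' : (0 : ℝ) < n := Nat.cast_pos.2 hn
  obtain ⟨R, hR⟩ := h.exists_forall_norm_lt
  refine (Set.finite_Icc (fun _ : Fin d => -⌈R * n⌉) (fun _ => ⌈R * n⌉)).subset fun k hk => ?_
  have hle : ‖fun i => (k i : ℝ) / n‖ ≤ R := not_lt.1 fun hlt => hk (hR _ hlt)
  have hki : ∀ i, |k i| ≤ ⌈R * n⌉ := fun i => by
    have h1 := (norm_le_pi_norm (fun i => (k i : ℝ) / n) i).trans hle
    rw [Real.norm_eq_abs, abs_div, abs_of_pos hn', div_le_iff₀ hn'] at h1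
    exact_mod_cast h1.trans (Int.le_ceil _)
  exact ⟨fun i => (abs_le.1 (hki i)).1, fun i => (abs_le.1 (hki i)).2⟩

end MemC

section Field

variable {d : ℕ} {Ω : Type*}

lemma summable_mul_lattice (ζ : (Fin d → ℤ) → Ω → ℝ) {φ : (Fin d → ℝ) → ℝ} (h : memC φ) {n : ℕ}
    (hn : 0 < n) (ω : Ω) :
    Summable fun k : Fin d → ℤ => ζ k ω * φ (fun i => (k i : ℝ) / n) :=
  summable_of_hasFiniteSupport
    ((h.finite_support_lattice hn).subset (Function.support_mul_subset_right _ _))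

lemma S_sum_mul (ζ : (Fin d → ℤ) → Ω → ℝ) {ι : Type*} (s : Finset ι)
    {φ : ι → (Fin d → ℝ) → ℝ} (h : ∀ i, memC (φ i)) (ξ : ι → ℝ) {n : ℕ} (hn : 0 < n) (ω : Ω) :
    S ζ n (fun x => ∑ i ∈ s, ξ i * φ i x) ω = ∑ i ∈ s, ξ i * S ζ n (φ i) ω := by
  have hsum : ∀ i ∈ s, Summable fun k : Fin d → ℤ =>
      ξ i * (ζ k ω * φ i (fun j => (k j : ℝ) / n)) :=
    fun i _ => (summable_mul_lattice ζ (h i) hn ω).mul_left _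
  have : ∀ k : Fin d → ℤ, ζ k ω * ∑ i ∈ s, ξ i * φ i (fun j => (k j : ℝ) / n) =
      ∑ i ∈ s, ξ i * (ζ k ω * φ i (fun j => (k j : ℝ) / n)) := fun k => by
    rw [Finset.mul_sum]
    exact Finset.sum_congr rfl fun i _ => by ring
  simp only [S, this]
  rw [Summable.tsum_finsetSum hsum, Finset.mul_sum]
  refine Finset.sum_congr rfl fun i _ => ?_
  rw [tsum_mul_left]
  ring

lemma S_sub (ζ : (Fin d → ℤ) → Ω → ℝ) {φ ψ : (Fin d → ℝ) → ℝ} (h : memC φ) (h' : memC ψ)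
    {n : ℕ} (hn : 0 < n) (ω : Ω) :
    S ζ n (fun x => φ x - ψ x) ω = S ζ n φ ω - S ζ n ψ ω := by
  simp only [S, mul_sub]
  rw [(summable_mul_lattice ζ h hn ω).tsum_sub (summable_mul_lattice ζ h' hn ω), mul_sub]

lemma S_eq_sum (ζ : (Fin d → ℤ) → Ω → ℝ) {φ : (Fin d → ℝ) → ℝ} (h : memC φ) {n : ℕ}
    (hn : 0 < n) (ω : Ω) :
    S ζ n φ ω = (n : ℝ) ^ (-(d : ℝ) / 2) * ∑ k ∈ (h.finite_support_lattice hn).toFinset,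
      φ (fun i => (k i : ℝ) / n) * ζ k ω := by
  rw [S, tsum_eq_sum (s := (h.finite_support_lattice hn).toFinset)]
  · simp only [mul_comm]
  · intro k hk
    have : φ (fun i => (k i : ℝ) / n) = 0 := by simpa using hk
    simp [this]

variable [MeasurableSpace Ω] {P : Measure Ω} {ζ : (Fin d → ℤ) → Ω → ℝ}

lemma measurable_S (hmeas : ∀ k, Measurable (ζ k)) {φ : (Fin d → ℝ) → ℝ} (h : memC φ) {n : ℕ}
    (hn : 0 < n) : Measurable (S ζ n φ) := by
  rw [show S ζ n φ = _ from funext (S_eq_sum ζ h hn)]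
  exact (Finset.measurable_sum _ fun k _ => (hmeas k).const_mul _).const_mul _

lemma Stationary.identDistrib (hstat : Stationary P ζ) (hmeas : ∀ k, Measurable (ζ k))
    (j : Fin d → ℤ) :
    ProbabilityTheory.IdentDistrib (fun ω k => ζ (k + j) ω) (fun ω k => ζ k ω) P P :=
  ⟨(measurable_pi_lambda _ fun k => hmeas (k + j)).aemeasurable,
    (measurable_pi_lambda _ fun k => hmeas k).aemeasurable, hstat j⟩

lemma Stationary.identDistrib_apply (hstat : Stationary P ζ) (hmeas : ∀ k, Measurable (ζ k))
    (k : Fin d → ℤ) : ProbabilityTheory.IdentDistrib (ζ k) (ζ 0) P P := by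
  simpa [Function.comp_def] using
    (hstat.identDistrib hmeas k).comp (measurable_pi_apply (0 : Fin d → ℤ))

lemma Stationary.memLp_two (hstat : Stationary P ζ) (hmeas : ∀ k, Measurable (ζ k))
    (hvar : Integrable (fun ω => (ζ 0 ω) ^ 2) P) (k : Fin d → ℤ) : MemLp (ζ k) 2 P :=
  (hstat.identDistrib_apply hmeas k).memLp_iff.2
    ((memLp_two_iff_integrable_sq (hmeas 0).aestronglyMeasurable).2 hvar)

lemma Stationary.integral_mul_eq_cov (hstat : Stationary P ζ) (hmeas : ∀ k, Measurable (ζ k))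
    (hmean : ∫ ω, ζ 0 ω ∂P = 0) (k l : Fin d → ℤ) :
    ∫ ω, ζ k ω * ζ l ω ∂P = cov P (ζ 0) (ζ (l - k)) := by
  have hmean' : ∫ ω, ζ (l - k) ω ∂P = 0 :=
    (hstat.identDistrib_apply hmeas (l - k)).integral_eq.trans hmean
  have hpair := ((hstat.identDistrib hmeas k).comp
    (u := fun x : (Fin d → ℤ) → ℝ => x 0 * x (l - k)) (by fun_prop)).integral_eq
  simpa [cov, hmean, hmean', Function.comp_def] using hpair

lemma Stationary.integral_sq_sum (hstat : Stationary P ζ) (hmeas : ∀ k, Measurable (ζ k))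
    (hmean : ∫ ω, ζ 0 ω ∂P = 0) (hvar : Integrable (fun ω => (ζ 0 ω) ^ 2) P)
    (F : Finset (Fin d → ℤ)) (a : (Fin d → ℤ) → ℝ) :
    ∫ ω, (∑ k ∈ F, a k * ζ k ω) ^ 2 ∂P =
      ∑ k ∈ F, ∑ l ∈ F, a k * a l * cov P (ζ 0) (ζ (l - k)) := by
  have hint : ∀ k l, Integrable (fun ω => a k * a l * (ζ k ω * ζ l ω)) P := fun k l =>
    ((hstat.memLp_two hmeas hvar k).integrable_mul (hstat.memLp_two hmeas hvar l)).const_mul _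
  have : ∀ ω, (∑ k ∈ F, a k * ζ k ω) ^ 2 =
      ∑ k ∈ F, ∑ l ∈ F, a k * a l * (ζ k ω * ζ l ω) := fun ω => by
    rw [sq, Finset.sum_mul_sum]
    exact Finset.sum_congr rfl fun k _ => Finset.sum_congr rfl fun l _ => by ring
  simp only [this]
  rw [integral_finsetSum _ fun k _ => integrable_finsetSum _ fun l _ => hint k l]
  refine Finset.sum_congr rfl fun k _ => ?_
  rw [integral_finsetSum _ fun l _ => hint k l]
  refine Finset.sum_congr rfl fun l _ => ?_
  rw [integral_const_mul, hstat.integral_mul_eq_cov hmeas hmean]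

/-- Schur-type bound for quadratic forms of convolution type on a discrete group. -/
lemma sum_mul_mul_le_of_summable_abs {G : Type*} [AddGroup G] {c : G → ℝ}
    (hc : Summable fun k => |c k|) (F : Finset G) (a : G → ℝ) :
    ∑ k ∈ F, ∑ l ∈ F, a k * a l * c (l - k) ≤ (∑' k, |c k|) * ∑ k ∈ F, a k ^ 2 := by
  have hrow : ∀ k, ∑ l ∈ F, |c (l - k)| ≤ ∑' k, |c k| := fun k => by
    have hinj : Function.Injective fun l : G => l - k := sub_left_injective
    calc ∑ l ∈ F, |c (l - k)| ≤ ∑' l, |c (l - k)| :=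
          (hc.comp_injective hinj).sum_le_tsum F fun _ _ => abs_nonneg _
      _ ≤ _ := tsum_comp_le_tsum_of_inj hc (fun _ => abs_nonneg _) hinj
  have hcol : ∀ l, ∑ k ∈ F, |c (l - k)| ≤ ∑' k, |c k| := fun l => by
    have hinj : Function.Injective fun k : G => l - k := sub_right_injective
    calc ∑ k ∈ F, |c (l - k)| ≤ ∑' k, |c (l - k)| :=
          (hc.comp_injective hinj).sum_le_tsum F fun _ _ => abs_nonneg _
      _ ≤ _ := tsum_comp_le_tsum_of_inj hc (fun _ => abs_nonneg _) hinj
  have hterm : ∀ k l, a k * a l * c (l - k) ≤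
      a k ^ 2 / 2 * |c (l - k)| + a l ^ 2 / 2 * |c (l - k)| := fun k l => by
    have h1 : |a k * a l| ≤ a k ^ 2 / 2 + a l ^ 2 / 2 := by
      rw [abs_mul]
      nlinarith [sq_nonneg (|a k| - |a l|), sq_abs (a k), sq_abs (a l)]
    calc a k * a l * c (l - k) ≤ |a k * a l| * |c (l - k)| := by
          rw [← abs_mul]; exact le_abs_self _
      _ ≤ (a k ^ 2 / 2 + a l ^ 2 / 2) * |c (l - k)| := by gcongr
      _ = _ := by ring
  calc ∑ k ∈ F, ∑ l ∈ F, a k * a l * c (l - k)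
      ≤ ∑ k ∈ F, ∑ l ∈ F, (a k ^ 2 / 2 * |c (l - k)| + a l ^ 2 / 2 * |c (l - k)|) :=
        Finset.sum_le_sum fun k _ => Finset.sum_le_sum fun l _ => hterm k l
    _ = (∑ k ∈ F, a k ^ 2 / 2 * ∑ l ∈ F, |c (l - k)|) +
          ∑ l ∈ F, a l ^ 2 / 2 * ∑ k ∈ F, |c (l - k)| := by
        simp only [Finset.sum_add_distrib, Finset.mul_sum]
        rw [Finset.sum_comm (f := fun k l => a l ^ 2 / 2 * |c (l - k)|)]
    _ ≤ (∑ k ∈ F, a k ^ 2 / 2 * ∑' k, |c k|) + ∑ l ∈ F, a l ^ 2 / 2 * ∑' k, |c k| := by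
        gcongr with k _ l _
        exacts [hrow k, hcol l]
    _ = _ := by
        rw [← Finset.sum_mul, ← Finset.sum_div]
        ring

lemma rpow_neg_half_sq (n d : ℕ) : ((n : ℝ) ^ (-(d : ℝ) / 2)) ^ 2 = ((n : ℝ) ^ d)⁻¹ := by
  rw [← Real.rpow_natCast, ← Real.rpow_mul (Nat.cast_nonneg n)]
  norm_num

/-- Second moment bound for `S_n(φ)` by a Riemann sum of `φ²`. -/
lemma Stationary.integral_S_sq_le (hstat : Stationary P ζ) (hmeas : ∀ k, Measurable (ζ k))
    (hmean : ∫ ω, ζ 0 ω ∂P = 0) (hvar : Integrable (fun ω => (ζ 0 ω) ^ 2) P)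
    (hSRD : Summable (fun k : Fin d → ℤ => |cov P (ζ 0) (ζ k)|))
    {φ : (Fin d → ℝ) → ℝ} (h : memC φ) {n : ℕ} (hn : 0 < n) :
    ∫ ω, S ζ n φ ω ^ 2 ∂P ≤ (∑' k : Fin d → ℤ, |cov P (ζ 0) (ζ k)|) *
      (((n : ℝ) ^ d)⁻¹ * ∑' k : Fin d → ℤ, φ (fun i => (k i : ℝ) / n) ^ 2) := by
  have hsq : ∑' k : Fin d → ℤ, φ (fun i => (k i : ℝ) / n) ^ 2 =
      ∑ k ∈ (h.finite_support_lattice hn).toFinset, φ (fun i => (k i : ℝ) / n) ^ 2 :=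
    tsum_eq_sum fun k hk => by
      have : φ (fun i => (k i : ℝ) / n) = 0 := by simpa using hk
      simp [this]
  simp only [S_eq_sum ζ h hn, mul_pow, rpow_neg_half_sq]
  rw [integral_const_mul, hstat.integral_sq_sum hmeas hmean hvar, hsq, mul_left_comm]
  gcongr
  exact sum_mul_mul_le_of_summable_abs hSRD _ _

lemma Stationary.memLp_S (hstat : Stationary P ζ) (hmeas : ∀ k, Measurable (ζ k))
    (hvar : Integrable (fun ω => (ζ 0 ω) ^ 2) P) {φ : (Fin d → ℝ) → ℝ} (h : memC φ) {n : ℕ}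
    (hn : 0 < n) : MemLp (S ζ n φ) 2 P := by
  rw [show S ζ n φ = _ from funext (S_eq_sum ζ h hn)]
  exact (memLp_finsetSum _ fun k _ => (hstat.memLp_two hmeas hvar k).const_mul _).const_mul _

/-- Proportion of the box `[0, m)^d` which stays in the box after translation by `j`. -/
lemma tendsto_card_box_inter (j : Fin d → ℤ) :
    Tendsto (fun m : ℕ => ((m : ℝ) ^ d)⁻¹ *
      ((((Fintype.piFinset fun _ : Fin d => Finset.Ico (0 : ℤ) m).filter
        fun k => k + j ∈ Fintype.piFinset fun _ : Fin d => Finset.Ico (0 : ℤ) m).card : ℕ) : ℝ))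
      atTop (𝓝 1) := by
  have hcard : ∀ m : ℕ, ((Fintype.piFinset fun _ : Fin d => Finset.Ico (0 : ℤ) m).filter
        fun k => k + j ∈ Fintype.piFinset fun _ : Fin d => Finset.Ico (0 : ℤ) m).card =
      ∏ i, (m - |j i|).toNat := fun m => by
    have : ((Fintype.piFinset fun _ : Fin d => Finset.Ico (0 : ℤ) m).filter
        fun k => k + j ∈ Fintype.piFinset fun _ : Fin d => Finset.Ico (0 : ℤ) m) =
        Fintype.piFinset fun i => Finset.Ico (max 0 (-j i)) (min (m : ℤ) (m - j i)) := by
      ext k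
      simp only [Finset.mem_filter, Fintype.mem_piFinset, Finset.mem_Ico, Pi.add_apply,
        ← forall_and]
      refine forall_congr' fun i => ?_
      rw [max_le_iff, lt_min_iff]
      omega
    rw [this, Fintype.card_piFinset]
    refine Finset.prod_congr rfl fun i _ => ?_
    rw [Int.card_Ico]
    congr 1
    rcases abs_cases (j i) with h | h <;> omega
  have hprod : Tendsto (fun m : ℕ => ∏ i, ((m : ℝ)⁻¹ * ((m : ℝ) - |(j i : ℝ)|))) atTop
      (𝓝 (∏ _i : Fin d, (1 : ℝ))) := by
    refine tendsto_finsetProd _ fun i _ => ?_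
    have hinv : Tendsto (fun m : ℕ => 1 - (m : ℝ)⁻¹ * |(j i : ℝ)|) atTop
        (𝓝 (1 - 0 * |(j i : ℝ)|)) :=
      tendsto_const_nhds.sub (tendsto_inv_atTop_nhds_zero_nat.mul_const _)
    rw [zero_mul, sub_zero] at hinv
    refine hinv.congr' ?_
    filter_upwards [eventually_gt_atTop 0] with m hm
    have : (m : ℝ) ≠ 0 := by positivity
    field_simp
  simp only [Finset.prod_const_one] at hprod
  refine hprod.congr' ?_
  have hlarge : ∀ᶠ m : ℕ in atTop, ∀ i, |j i| ≤ m := by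
    refine eventually_all.2 fun i => ?_
    filter_upwards [eventually_ge_atTop (j i).natAbs] with m hm
    rw [Int.abs_eq_natAbs]
    exact_mod_cast hm
  filter_upwards [hlarge] with m hm
  rw [hcard, Finset.prod_mul_distrib, Finset.prod_const, Finset.card_univ, Fintype.card_fin,
    inv_pow]
  push_cast
  congr 1
  refine Finset.prod_congr rfl fun i _ => ?_
  have h0 : ((m - |j i|).toNat : ℤ) = m - |j i| := Int.toNat_of_nonneg (sub_nonneg.2 (hm i))
  have h1 := congrArg (Int.cast (R := ℝ)) h0
  push_cast at h1
  exact h1.symm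

/-- A summable function of positive type on `ℤ^d` has nonnegative sum. -/
lemma tsum_nonneg_of_forall_sum_sum_nonneg {c : (Fin d → ℤ) → ℝ} (hc : Summable fun k => |c k|)
    (hpos : ∀ F : Finset (Fin d → ℤ), 0 ≤ ∑ k ∈ F, ∑ l ∈ F, c (l - k)) : 0 ≤ ∑' k, c k := by
  let Q : ℕ → Finset (Fin d → ℤ) := fun m =>
    Fintype.piFinset fun _ : Fin d => Finset.Ico (0 : ℤ) m
  let w : ℕ → (Fin d → ℤ) → ℝ := fun m j =>
    ((m : ℝ) ^ d)⁻¹ * (((Q m).filter fun k => k + j ∈ Q m).card : ℝ)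
  have hQ : ∀ m, (((Q m).card : ℕ) : ℝ) = (m : ℝ) ^ d := fun m => by
    simp [Q, Fintype.card_piFinset]
  have hw0 : ∀ m j, 0 ≤ w m j := fun m j => by positivity
  have hw1 : ∀ m j, w m j ≤ 1 := fun m j => by
    have : (((Q m).filter fun k => k + j ∈ Q m).card : ℝ) ≤ (m : ℝ) ^ d := by
      rw [← hQ]
      exact_mod_cast Finset.card_filter_le _ _
    calc w m j ≤ ((m : ℝ) ^ d)⁻¹ * (m : ℝ) ^ d :=
          mul_le_mul_of_nonneg_left this (by positivity)
      _ ≤ 1 := inv_mul_le_one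
  have hlim : Tendsto (fun m => ∑' j, w m j * c j) atTop (𝓝 (∑' j, c j)) := by
    refine tendsto_tsum_of_dominated_convergence hc (fun j => ?_)
      (Eventually.of_forall fun m j => ?_)
    · have hj := (tendsto_card_box_inter j).mul_const (c j)
      rwa [one_mul] at hj
    · rw [norm_mul, Real.norm_of_nonneg (hw0 m j), Real.norm_eq_abs]
      exact mul_le_of_le_one_left (abs_nonneg _) (hw1 m j)
  refine ge_of_tendsto' hlim fun m => ?_
  have hrow : ∀ k, Summable fun j => if k + j ∈ Q m then c j else 0 := fun k =>
    hc.of_norm_bounded fun j => by split_ifs <;> simp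
  have hshift : ∀ k, ∑' j, (if k + j ∈ Q m then c j else 0) = ∑ l ∈ Q m, c (l - k) := fun k => by
    rw [← (Equiv.subRight k).tsum_eq]
    simp only [Equiv.subRight_apply, add_sub_cancel]
    rw [tsum_eq_sum (s := Q m) fun l hl => by simp [hl]]
    exact Finset.sum_congr rfl fun l hl => by simp [hl]
  have heq : ∑' j, w m j * c j = ((m : ℝ) ^ d)⁻¹ * ∑ k ∈ Q m, ∑ l ∈ Q m, c (l - k) := by
    rw [← Finset.sum_congr rfl fun k _ => hshift k, ← Summable.tsum_finsetSum fun k _ => hrow k,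
      ← tsum_mul_left]
    refine tsum_congr fun j => ?_
    rw [← Finset.sum_filter, Finset.sum_const, nsmul_eq_mul, ← mul_assoc]
  rw [heq]
  exact mul_nonneg (by positivity) (hpos _)

lemma Stationary.tsum_cov_nonneg (hstat : Stationary P ζ) (hmeas : ∀ k, Measurable (ζ k))
    (hmean : ∫ ω, ζ 0 ω ∂P = 0) (hvar : Integrable (fun ω => (ζ 0 ω) ^ 2) P)
    (hSRD : Summable (fun k : Fin d → ℤ => |cov P (ζ 0) (ζ k)|)) :
    0 ≤ ∑' k : Fin d → ℤ, cov P (ζ 0) (ζ k) := by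
  refine tsum_nonneg_of_forall_sum_sum_nonneg hSRD fun F => ?_
  have := hstat.integral_sq_sum hmeas hmean hvar F fun _ => 1
  simp only [one_mul] at this
  rw [← this]
  exact integral_nonneg fun ω => sq_nonneg _

end Field

section CharacteristicFunction

variable {d : ℕ} {Ω : Type*} [MeasurableSpace Ω] {P : Measure Ω} [IsProbabilityMeasure P]

lemma integrable_exp_I_mul {X : Ω → ℝ} (hX : Measurable X) :
    Integrable (fun ω => Complex.exp (Complex.I * (X ω : ℂ))) P :=
  Integrable.of_bound (C := 1) (by fun_prop)
    (Eventually.of_forall fun ω => (Complex.norm_exp_I_mul_ofReal _).le)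

lemma integral_abs_le_sqrt_integral_sq {X : Ω → ℝ} (hX : MemLp X 2 P) :
    ∫ ω, |X ω| ∂P ≤ Real.sqrt (∫ ω, X ω ^ 2 ∂P) := by
  refine Real.le_sqrt_of_sq_le ?_
  have hvar := ProbabilityTheory.variance_eq_sub hX.abs
  have hnonneg := ProbabilityTheory.variance_nonneg (fun ω => |X ω|) P
  simp only [Pi.pow_apply, Pi.abs_apply, sq_abs] at hvar
  change ProbabilityTheory.variance (fun ω => |X ω|) P = _ - (∫ ω, |X ω| ∂P) ^ 2 at hvar
  linarith

lemma norm_integral_exp_I_mul_sub_le {X Y : Ω → ℝ} (hX : Measurable X) (hY : Measurable Y)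
    (hXY : MemLp (fun ω => X ω - Y ω) 2 P) :
    ‖(∫ ω, Complex.exp (Complex.I * (X ω : ℂ)) ∂P) - ∫ ω, Complex.exp (Complex.I * (Y ω : ℂ)) ∂P‖
      ≤ Real.sqrt (∫ ω, (X ω - Y ω) ^ 2 ∂P) := by
  rw [← integral_sub (integrable_exp_I_mul hX) (integrable_exp_I_mul hY)]
  refine (norm_integral_le_of_norm_le ((hXY.integrable one_le_two).abs)
    (Eventually.of_forall fun ω => ?_)).trans (integral_abs_le_sqrt_integral_sq hXY)
  have hfac : Complex.exp (Complex.I * (X ω : ℂ)) - Complex.exp (Complex.I * (Y ω : ℂ)) =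
      Complex.exp (Complex.I * (Y ω : ℂ)) *
        (Complex.exp (Complex.I * ((X ω - Y ω : ℝ) : ℂ)) - 1) := by
    rw [mul_sub, ← Complex.exp_add, mul_one]
    congr 2
    push_cast
    ring
  rw [hfac, norm_mul, Complex.norm_exp_I_mul_ofReal, one_mul]
  exact Real.norm_exp_I_mul_ofReal_sub_one_le

lemma integral_exp_I_mul_eq {X : Ω → ℝ} (hX : Measurable X) :
    ∫ ω, Complex.exp (Complex.I * (X ω : ℂ)) ∂P =
      ((∫ ω, Real.cos (X ω) ∂P : ℝ) : ℂ) + ((∫ ω, Real.sin (X ω) ∂P : ℝ) : ℂ) * Complex.I := by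
  rw [← integral_re_add_im (integrable_exp_I_mul hX)]
  simp [mul_comm Complex.I, Complex.exp_ofReal_mul_I_re, Complex.exp_ofReal_mul_I_im]

/-- Convergence against bounded continuous functions to a centered Gaussian law implies
convergence of the characteristic functions at `1`. -/
lemma tendsto_integral_exp_I_mul_of_tendsto_gaussianReal {X : ℕ → Ω → ℝ}
    (hX : ∀ᶠ n in atTop, Measurable (X n)) {v : ℝ} (hv : 0 ≤ v)
    (h : ∀ f : BoundedContinuousFunction ℝ ℝ, Tendsto (fun n => ∫ ω, f (X n ω) ∂P) atTop
      (𝓝 (∫ x, f x ∂(ProbabilityTheory.gaussianReal 0 v.toNNReal)))) :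
    Tendsto (fun n => ∫ ω, Complex.exp (Complex.I * (X n ω : ℂ)) ∂P) atTop
      (𝓝 (Complex.exp (-(v : ℂ) / 2))) := by
  let fc : BoundedContinuousFunction ℝ ℝ :=
    BoundedContinuousFunction.ofNormedAddCommGroup Real.cos Real.continuous_cos 1
      fun x => Real.abs_cos_le_one x
  let fs : BoundedContinuousFunction ℝ ℝ :=
    BoundedContinuousFunction.ofNormedAddCommGroup Real.sin Real.continuous_sin 1
      fun x => Real.abs_sin_le_one x
  have hgauss : ∫ x : ℝ, Complex.exp (Complex.I * (x : ℂ))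
      ∂(ProbabilityTheory.gaussianReal 0 v.toNNReal) = Complex.exp (-(v : ℂ) / 2) := by
    have := ProbabilityTheory.charFun_gaussianReal (μ := 0) (v := v.toNNReal) 1
    rw [charFun_apply_real] at this
    simp only [Complex.ofReal_one, one_mul, Complex.ofReal_zero, mul_zero, zero_mul, zero_sub,
      one_pow, mul_one, Real.coe_toNNReal v hv] at this
    simpa [mul_comm Complex.I, neg_div] using this
  rw [← hgauss, integral_exp_I_mul_eq measurable_id']
  refine Tendsto.congr' ?_ (((Complex.continuous_ofReal.tendsto _).comp (h fc)).add
    (((Complex.continuous_ofReal.tendsto _).comp (h fs)).mul_const Complex.I))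
  filter_upwards [hX] with n hn
  exact (integral_exp_I_mul_eq hn).symm

end CharacteristicFunction

section Limit

variable {d : ℕ}

lemma memC.abs_integral_sq_sub_le {φ ψ : (Fin d → ℝ) → ℝ} (h : memC φ) (h' : memC ψ) {ε : ℝ}
    (hε : 0 < ε) (hle : ∫ x, (φ x - ψ x) ^ 2 ≤ ε ^ 2) :
    |(∫ x, ψ x ^ 2) - ∫ x, φ x ^ 2| ≤ ε ^ 2 + ε + ε * ∫ x, φ x ^ 2 := by
  have hi := (h.sub h').sq.integrable
  rw [← integral_sub h'.sq.integrable h.sq.integrable]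
  calc |∫ x, (ψ x ^ 2 - φ x ^ 2)| ≤ ∫ x, ((1 + ε⁻¹) * (φ x - ψ x) ^ 2 + ε * φ x ^ 2) := by
        refine norm_integral_le_of_norm_le (f := fun x => ψ x ^ 2 - φ x ^ 2)
          ((hi.const_mul _).add (h.sq.integrable.const_mul _))
          (Eventually.of_forall fun x => ?_)
        have hkey : 2 * |φ x| * |φ x - ψ x| ≤ ε⁻¹ * (φ x - ψ x) ^ 2 + ε * φ x ^ 2 := by
          have h1 : 0 ≤ ε⁻¹ * (|φ x - ψ x| - ε * |φ x|) ^ 2 := by positivity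
          have h2 : ε⁻¹ * (|φ x - ψ x| - ε * |φ x|) ^ 2 =
              ε⁻¹ * |φ x - ψ x| ^ 2 + ε * |φ x| ^ 2 - 2 * |φ x| * |φ x - ψ x| := by
            field_simp
            ring
          rw [sq_abs, sq_abs] at h2
          linarith
        have habs : |2 * φ x * (φ x - ψ x)| = 2 * |φ x| * |φ x - ψ x| := by
          rw [abs_mul, abs_mul, abs_two]
        rw [Real.norm_eq_abs, show ψ x ^ 2 - φ x ^ 2 =
          (φ x - ψ x) ^ 2 - 2 * φ x * (φ x - ψ x) by ring]
        refine (abs_sub _ _).trans ?_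
        rw [habs, abs_of_nonneg (sq_nonneg (φ x - ψ x))]
        linarith
    _ = (1 + ε⁻¹) * (∫ x, (φ x - ψ x) ^ 2) + ε * ∫ x, φ x ^ 2 := by
        rw [integral_add (hi.const_mul _) (h.sq.integrable.const_mul _), integral_const_mul,
          integral_const_mul]
    _ ≤ (1 + ε⁻¹) * ε ^ 2 + ε * ∫ x, φ x ^ 2 := by gcongr
    _ = _ := by field_simp

lemma tendsto_of_approx {E ι : Type*} [SeminormedAddCommGroup E] {l : Filter ι} {u : ι → E} {a : E}
    (h : ∀ ε > 0, ∃ (v : ι → E) (b : E), Tendsto v l (𝓝 b) ∧ (∀ᶠ i in l, ‖u i - v i‖ < ε) ∧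
      ‖b - a‖ < ε) : Tendsto u l (𝓝 a) := by
  refine Metric.tendsto_nhds.2 fun ε hε => ?_
  obtain ⟨v, b, hv, huv, hba⟩ := h (ε / 3) (by positivity)
  filter_upwards [huv, Metric.tendsto_nhds.1 hv (ε / 3) (by positivity)] with i h1 h2
  rw [← dist_eq_norm] at h1 hba
  linarith [dist_triangle (u i) (v i) a, dist_triangle (v i) b a]

/-- One-dimensional version of the extension from `𝒟` to `𝒞`. -/
lemma tendsto_integral_exp_I_mul_S {Ω : Type*} [MeasurableSpace Ω]
    {P : Measure Ω} [IsProbabilityMeasure P] {ζ : (Fin d → ℤ) → Ω → ℝ}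
    (hmeas : ∀ k, Measurable (ζ k)) (hstat : Stationary P ζ)
    (hmean : ∫ ω, ζ 0 ω ∂P = 0) (hvar : Integrable (fun ω => (ζ 0 ω) ^ 2) P)
    (hSRD : Summable (fun k : Fin d → ℤ => |cov P (ζ 0) (ζ k)|))
    {D : Set ((Fin d → ℝ) → ℝ)} (hDsub : ∀ ψ ∈ D, memC ψ)
    (hdense : ∀ φ : (Fin d → ℝ) → ℝ, memC φ → ∀ ε : ℝ, 0 < ε →
      ∃ ψ ∈ D, Real.sqrt (∫ x : Fin d → ℝ, (φ x - ψ x) ^ 2) < ε)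
    (hconv : ∀ ψ ∈ D, ∀ f : BoundedContinuousFunction ℝ ℝ,
      Tendsto (fun n : ℕ => ∫ ω, f (S ζ n ψ ω) ∂P) atTop
        (𝓝 (∫ x, f x ∂(ProbabilityTheory.gaussianReal 0
          (Real.toNNReal ((∑' k : Fin d → ℤ, cov P (ζ 0) (ζ k)) *
            ∫ x : Fin d → ℝ, (ψ x) ^ 2))))))
    {φ : (Fin d → ℝ) → ℝ} (h : memC φ) :
    Tendsto (fun n : ℕ => ∫ ω, Complex.exp (Complex.I * (S ζ n φ ω : ℂ)) ∂P) atTop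
      (𝓝 (Complex.exp
        (-(((∑' k : Fin d → ℤ, cov P (ζ 0) (ζ k)) * ∫ x, φ x ^ 2 : ℝ) : ℂ) / 2))) := by
  set σ : ℝ := ∑' k : Fin d → ℤ, cov P (ζ 0) (ζ k)
  set τ : ℝ := ∑' k : Fin d → ℤ, |cov P (ζ 0) (ζ k)|
  have hσ0 : 0 ≤ σ := hstat.tsum_cov_nonneg hmeas hmean hvar hSRD
  have hτ0 : 0 ≤ τ := tsum_nonneg fun _ => abs_nonneg _
  choose ψ hψD hψ using fun m : ℕ => hdense φ h (1 / (m + 1)) (by positivity)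
  have hψC : ∀ m, memC (ψ m) := fun m => hDsub _ (hψD m)
  have hε : Tendsto (fun m : ℕ => (1 : ℝ) / (m + 1)) atTop (𝓝 0) :=
    tendsto_one_div_add_atTop_nhds_zero_nat
  have hψ2 : ∀ m : ℕ, ∫ x, (φ x - ψ m x) ^ 2 ≤ (1 / (m + 1)) ^ 2 := fun m =>
    (Real.sqrt_le_left (by positivity)).1 (hψ m).le
  have hnorm : Tendsto (fun m => ∫ x, ψ m x ^ 2) atTop (𝓝 (∫ x, φ x ^ 2)) := by
    refine tendsto_iff_norm_sub_tendsto_zero.2 (squeeze_zero (fun _ => norm_nonneg _)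
      (fun m => h.abs_integral_sq_sub_le (hψC m) (by positivity) (hψ2 m)) ?_)
    simpa using ((hε.pow 2).add hε).add (hε.mul_const (∫ x, φ x ^ 2))
  have hchar : Tendsto (fun m => Complex.exp (-((σ * ∫ x, ψ m x ^ 2 : ℝ) : ℂ) / 2)) atTop
      (𝓝 (Complex.exp (-((σ * ∫ x, φ x ^ 2 : ℝ) : ℂ) / 2))) := by
    have hc : Continuous fun v : ℝ => Complex.exp (-((σ * v : ℝ) : ℂ) / 2) := by fun_prop
    exact (hc.tendsto _).comp hnorm
  have hsmall : Tendsto (fun m : ℕ => Real.sqrt (τ * (1 / (m + 1)) ^ 2)) atTop (𝓝 0) := by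
    have := (Real.continuous_sqrt.tendsto _).comp ((hε.pow 2).const_mul τ)
    simpa [Function.comp_def] using this
  refine tendsto_of_approx fun ε hεpos => ?_
  obtain ⟨m, hm1, hm2⟩ := ((hsmall.eventually_lt_const hεpos).and
    (Metric.tendsto_nhds.1 hchar ε hεpos)).exists
  refine ⟨_, _, tendsto_integral_exp_I_mul_of_tendsto_gaussianReal
    ((eventually_gt_atTop 0).mono fun n hn => measurable_S hmeas (hψC m) hn)
    (mul_nonneg hσ0 (integral_nonneg fun x => sq_nonneg _)) (hconv _ (hψD m)), ?_, ?_⟩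
  · have hdiff : memC fun x => φ x - ψ m x := h.sub (hψC m)
    have hR := (Real.continuous_sqrt.tendsto _).comp (hdiff.sq.tendsto_riemannSum.const_mul τ)
    have hlt : Real.sqrt (τ * ∫ x, (φ x - ψ m x) ^ 2) < ε :=
      (Real.sqrt_le_sqrt (mul_le_mul_of_nonneg_left (hψ2 m) hτ0)).trans_lt hm1
    filter_upwards [hR.eventually_lt_const hlt, eventually_gt_atTop 0] with n hn hn0
    have hS := S_sub ζ h (hψC m) hn0
    refine (norm_integral_exp_I_mul_sub_le (measurable_S hmeas h hn0)
      (measurable_S hmeas (hψC m) hn0) ?_).trans_lt (lt_of_le_of_lt ?_ hn)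
    · simpa only [← hS] using hstat.memLp_S hmeas hvar hdiff hn0
    · simp only [← hS]
      exact Real.sqrt_le_sqrt (hstat.integral_S_sq_le hmeas hmean hvar hSRD hdiff hn0)
  · rwa [dist_eq_norm] at hm2

end Limit

/-- If `𝒟 ⊆ 𝒞` is dense in the `L²(ℝ^d)` norm and
`S_n(ψ) → N(0, σ²‖ψ‖²_{L²})` in distribution for every `ψ ∈ 𝒟`, then the
finite-dimensional distributions of `{S_n(φ); φ ∈ 𝒞}` converge to those of
`{σW(φ); φ ∈ 𝒞}`: for all `φ₁, …, φ_N ∈ 𝒞` the law of `(S_n(φ₁), …, S_n(φ_N))`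
converges weakly to the centered Gaussian law on `ℝ^N` with covariance matrix
`σ² ∫ φ_i φ_j`; equivalently (by Lévy's continuity theorem) the characteristic
functions converge to the characteristic function of that Gaussian law. -/
theorem stmt4 {d : ℕ} [NeZero d] {Ω : Type*} [MeasurableSpace Ω]
    (P : Measure Ω) [IsProbabilityMeasure P]
    (ζ : (Fin d → ℤ) → Ω → ℝ)
    (hmeas : ∀ k, Measurable (ζ k))
    (hstat : Stationary P ζ)
    (hmean : ∫ ω, ζ 0 ω ∂P = 0)
    (hvar : Integrable (fun ω => (ζ 0 ω) ^ 2) P)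
    (hSRD : Summable (fun k : Fin d → ℤ => |cov P (ζ 0) (ζ k)|))
    (D : Set ((Fin d → ℝ) → ℝ))
    (hDsub : ∀ ψ ∈ D, memC ψ)
    (hdense : ∀ φ : (Fin d → ℝ) → ℝ, memC φ → ∀ ε : ℝ, 0 < ε →
      ∃ ψ ∈ D, Real.sqrt (∫ x : Fin d → ℝ, (φ x - ψ x) ^ 2) < ε)
    (hconv : ∀ ψ ∈ D, ∀ f : BoundedContinuousFunction ℝ ℝ,
      Tendsto (fun n : ℕ => ∫ ω, f (S ζ n ψ ω) ∂P) atTop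
        (𝓝 (∫ x, f x ∂(ProbabilityTheory.gaussianReal 0
          (Real.toNNReal ((∑' k : Fin d → ℤ, cov P (ζ 0) (ζ k)) *
            ∫ x : Fin d → ℝ, (ψ x) ^ 2)))))) :
    ∀ N : ℕ, 1 ≤ N → ∀ φ : Fin N → (Fin d → ℝ) → ℝ, (∀ i, memC (φ i)) →
      ∀ ξ : Fin N → ℝ,
        Tendsto (fun n : ℕ =>
            ∫ ω, Complex.exp (Complex.I * ((∑ i, ξ i * S ζ n (φ i) ω : ℝ) : ℂ)) ∂P)
          atTop
          (𝓝 (Complex.exp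
            (-(((∑ i, ∑ j, ξ i * ξ j *
                ((∑' k : Fin d → ℤ, cov P (ζ 0) (ζ k)) *
                  ∫ x : Fin d → ℝ, φ i x * φ j x) : ℝ) : ℂ) / 2)))) := by
  intro N _ φ hφ ξ
  have hlim := tendsto_integral_exp_I_mul_S hmeas hstat hmean hvar hSRD hDsub hdense hconv
    (memC.sum Finset.univ fun i => (hφ i).const_mul (ξ i))
  have hsq : ∫ x, (∑ i, ξ i * φ i x) ^ 2 = ∑ i, ∑ j, ξ i * ξ j * ∫ x, φ i x * φ j x := by
    have hint : ∀ i j, Integrable fun x => ξ i * ξ j * (φ i x * φ j x) := fun i j =>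
      ((hφ i).mul (hφ j)).integrable.const_mul _
    have hexp : ∀ x, (∑ i, ξ i * φ i x) ^ 2 = ∑ i, ∑ j, ξ i * ξ j * (φ i x * φ j x) := fun x => by
      rw [sq, Finset.sum_mul_sum]
      exact Finset.sum_congr rfl fun i _ => Finset.sum_congr rfl fun j _ => by ring
    simp only [hexp]
    rw [integral_finsetSum _ fun i _ => integrable_finsetSum _ fun j _ => hint i j]
    refine Finset.sum_congr rfl fun i _ => ?_
    rw [integral_finsetSum _ fun j _ => hint i j]
    exact Finset.sum_congr rfl fun j _ => integral_const_mul _ _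
  rw [hsq, neg_div] at hlim
  have hcov : ∀ i j, ξ i * ξ j * ((∑' k : Fin d → ℤ, cov P (ζ 0) (ζ k)) *
      ∫ x : Fin d → ℝ, φ i x * φ j x) =
      (∑' k : Fin d → ℤ, cov P (ζ 0) (ζ k)) * (ξ i * ξ j * ∫ x : Fin d → ℝ, φ i x * φ j x) :=
    fun i j => by ring
  simp only [hcov, ← Finset.mul_sum]
  refine hlim.congr' ?_
  filter_upwards [eventually_gt_atTop 0] with n hn
  simp only [S_sum_mul ζ Finset.univ hφ ξ hn]
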